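/- Let n ≥ 3 be odd and let 2 ≤ r ≤ n − 1. Define ℓ_min^Tour(n,r) as the minimum over all strong tournaments T on {1,…,n} of max{ℓ(T, α) : α ∈ Sing_n, rk(α) = r}, and ℓ_max^Tour(n,r) as the corresponding maximum over all strong tournaments T on {1,…,n}. Then n + r − 2 ≤ ℓ_min^Tour(n,r) ≤ n + 8r, and (r̂ + 1)(n − r̂) − 1 ≤ ℓ_max^Tour(n,r) ≤ 6rn + n − 10r, where r̂ = min{r − 1, ⌊n/2⌋}. -/

import Mathlib

noncomputable section

variable {V : Type*}

/-- The arc `(a→b)`: the map sending `a` to `b` and fixing every other point. -/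
def arcMap [DecidableEq V] (a b : V) : V → V := fun x => if x = a then b else x

/-- Evaluate a word of arcs, applying the arcs from left to right. -/
def wordEval [DecidableEq V] (w : List (V × V)) : V → V :=
  fun x => w.foldl (fun y e => arcMap e.1 e.2 y) x

/-- `α ∈ ⟨D⟩`: `α` is a (nonempty) product of arcs of the digraph `D`. -/
def InGen [DecidableEq V] (D : V → V → Prop) (α : V → V) : Prop :=
  ∃ w : List (V × V), w ≠ [] ∧ (∀ e ∈ w, D e.1 e.2) ∧ wordEval w = α

/-- `ℓ(D, α)`: the minimal length of a word in the arcs of `D` expressing `α`. -/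
def arcLen [DecidableEq V] (D : V → V → Prop) (α : V → V) : ℕ :=
  sInf {k | ∃ w : List (V × V), w.length = k ∧ (∀ e ∈ w, D e.1 e.2) ∧ wordEval w = α}

/-- `fix(α)`: the number of fixed points of `α`. -/
def fixCnt (α : V → V) : ℕ := Set.ncard {x | α x = x}

/-- `rk(α)`: the rank of `α`, i.e. the cardinality of its image. -/
def rnk (α : V → V) : ℕ := Set.ncard (Set.range α)

/-- A set `C` is a cyclic orbit of `α` if it is a weakly connected component of the
functional digraph of `α` (edges `(x, α x)`) which is a directed cycle on at least two
vertices: equivalently, `C` is the forward orbit of a periodic point, has at least two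
elements, and is closed under taking preimages. -/
def IsCyclicOrbit (α : V → V) (C : Set V) : Prop :=
  2 ≤ C.ncard ∧ (∃ x ∈ C, (∃ k, 0 < k ∧ α^[k] x = x) ∧ C = {y | ∃ k, α^[k] x = y}) ∧
    ∀ y : V, α y ∈ C → y ∈ C

/-- `cycl(α)`: the number of cyclic orbits of `α`. -/
def cyclCnt (α : V → V) : ℕ := Set.ncard {C : Set V | IsCyclicOrbit α C}

/-- `D` is connected: any two vertices are joined by a directed path in some direction. -/
def ConnectedDigraph (D : V → V → Prop) : Prop :=
  ∀ u v : V, Relation.ReflTransGen D u v ∨ Relation.ReflTransGen D v u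

/-- `D` is closed (equal to its closure): whenever `(b,a)` is an edge lying on a directed
cycle of `D` (i.e. there is a directed path from `a` back to `b`), `(a,b)` is also an edge. -/
def ClosedDigraph (D : V → V → Prop) : Prop :=
  ∀ a b : V, D b a → Relation.ReflTransGen D a b → D a b

/-- Property (★): if `v0, v1, v2` is a directed path with `d_D(v0,v2) = 2`, then every
out-neighbour of `v1` and of `v2` lies in `{v0, v1, v2}`. -/
def StarCond (D : V → V → Prop) : Prop :=
  ∀ v0 v1 v2 : V, D v0 v1 → D v1 v2 → v0 ≠ v2 → ¬ D v0 v2 →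
    ∀ u : V, (D v1 u ∨ D v2 u) → (u = v0 ∨ u = v1 ∨ u = v2)

/-- `C` is a strong component of `D`. -/
def IsSC (D : V → V → Prop) (C : Set V) : Prop :=
  ∃ v : V, C = {u | Relation.ReflTransGen D u v ∧ Relation.ReflTransGen D v u}

/-- `C1` connects to `C2`: some edge goes from `C1` to `C2`. -/
def ConnectsTo (D : V → V → Prop) (C1 C2 : Set V) : Prop :=
  ∃ v1 ∈ C1, ∃ v2 ∈ C2, D v1 v2

/-- `C1` fully connects to `C2`: all pairs are edges. -/
def FullyConnects (D : V → V → Prop) (C1 C2 : Set V) : Prop :=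
  ∀ v1 ∈ C1, ∀ v2 ∈ C2, D v1 v2

/-- A terminal strong component: it connects to no other strong component. -/
def IsTerminalSC (D : V → V → Prop) (C : Set V) : Prop :=
  IsSC D C ∧ ∀ C' : Set V, IsSC D C' → C' ≠ C → ¬ ConnectsTo D C C'

/-- Property (★★): nonterminal strong components have at most 2 vertices and terminal
strong components have at most 3 vertices. -/
def StarStarCond (D : V → V → Prop) : Prop :=
  ∀ C : Set V, IsSC D C →
    (IsTerminalSC D C → C.ncard ≤ 3) ∧ (¬ IsTerminalSC D C → C.ncard ≤ 2)

/-- The induced subdigraph on `C` is an undirected path `a - b - c` on three vertices. -/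
def IsP3 (D : V → V → Prop) (C : Set V) : Prop :=
  ∃ a b c : V, a ≠ b ∧ b ≠ c ∧ a ≠ c ∧ C = {a, b, c} ∧
    ∀ u ∈ C, ∀ w ∈ C,
      (D u w ↔ (u = a ∧ w = b) ∨ (u = b ∧ w = a) ∨ (u = b ∧ w = c) ∨ (u = c ∧ w = b))

/-- `D` has a subdigraph isomorphic to `H`: an injection mapping edges of `H` to edges of `D`. -/
def HasSubdigraph (D : V → V → Prop) {m : ℕ} (H : Fin m → Fin m → Prop) : Prop :=
  ∃ f : Fin m → V, Function.Injective f ∧ ∀ i j : Fin m, H i j → D (f i) (f j)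

/-- `Θ_k`: the directed cycle on `k` vertices. -/
def Theta (k : ℕ) : Fin k → Fin k → Prop := fun i j => (j : ℕ) = ((i : ℕ) + 1) % k

/-- `Γ1` (vertices relabelled from `{1,…,5}` to `{0,…,4}`). -/
def Gamma1 : Fin 5 → Fin 5 → Prop := fun i j =>
  ((i : ℕ), (j : ℕ)) ∈ [(0,3),(3,0),(1,3),(3,1),(2,3),(3,2),(3,4)]

/-- `Γ2` (vertices relabelled from `{1,…,5}` to `{0,…,4}`). -/
def Gamma2 : Fin 5 → Fin 5 → Prop := fun i j =>
  ((i : ℕ), (j : ℕ)) ∈ [(0,2),(2,0),(1,2),(2,1),(2,3),(3,2),(3,4)]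

/-- `Γ3` (vertices relabelled from `{1,…,4}` to `{0,…,3}`). -/
def Gamma3 : Fin 4 → Fin 4 → Prop := fun i j =>
  ((i : ℕ), (j : ℕ)) ∈ [(0,1),(1,2),(2,0),(2,3)]

/-- `Γ4` (vertices relabelled from `{1,…,5}` to `{0,…,4}`). -/
def Gamma4 : Fin 5 → Fin 5 → Prop := fun i j =>
  ((i : ℕ), (j : ℕ)) ∈ [(0,1),(1,2),(2,3),(3,0),(3,4)]

/-- No subdigraph isomorphic to `Γ1`, `Γ2`, `Γ3`, `Γ4` or `Θ_k` for `k ≥ 5`. -/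
def ForbiddenFree (D : V → V → Prop) : Prop :=
  ¬ HasSubdigraph D Gamma1 ∧ ¬ HasSubdigraph D Gamma2 ∧ ¬ HasSubdigraph D Gamma3 ∧
    ¬ HasSubdigraph D Gamma4 ∧ ∀ k : ℕ, 5 ≤ k → ¬ HasSubdigraph D (Theta k)

/-- `D` is acyclic: it has no directed cycle. -/
def AcyclicRel (D : V → V → Prop) : Prop := ∀ v : V, ¬ Relation.TransGen D v v

/-- `ψ_A(u,w)`: the maximal number of edges of a directed path from `u` to `w` in `A`
(in particular `ψ_A(u,u) = 0`). -/
def psiLongest (A : V → V → Prop) (u w : V) : ℕ :=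
  sSup {l | ∃ p : List V, p.Chain' A ∧ p.Nodup ∧
    p.head? = some u ∧ p.getLast? = some w ∧ p.length = l + 1}

/-- `d_D(u,w)`: the minimal number of edges of a directed path from `u` to `w` in `D`. -/
def ddist (D : V → V → Prop) (u w : V) : ℕ :=
  sInf {l | ∃ p : List V, p.Chain' D ∧ p.head? = some u ∧ p.getLast? = some w ∧
    p.length = l + 1}

/-- A tournament: no loops, and exactly one of `(u,v)`, `(v,u)` is an edge for `u ≠ v`. -/
def IsTournament (D : V → V → Prop) : Prop :=
  (∀ v : V, ¬ D v v) ∧ ∀ u v : V, u ≠ v → (D u v ∨ D v u) ∧ ¬ (D u v ∧ D v u)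

/-- A strong (strongly connected) digraph. -/
def IsStrongDigraph (D : V → V → Prop) : Prop :=
  ∀ u v : V, Relation.ReflTransGen D u v

/-- `ℓ(T, r)`: the maximum of `ℓ(T, α)` over all singular maps `α` of rank `r`
(for a strong tournament `T` on at least 3 vertices, `⟨T⟩ = Sing_n`). -/
def tourRankLen (n : ℕ) (T : Fin n → Fin n → Prop) (r : ℕ) : ℕ :=
  sSup {k | ∃ α : Fin n → Fin n, ¬ Function.Bijective α ∧ rnk α = r ∧ arcLen T α = k}

/-- `ℓ_min^Tour(n, r)`. -/
def lminTour (n r : ℕ) : ℕ :=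
  sInf {m | ∃ T : Fin n → Fin n → Prop, IsTournament T ∧ IsStrongDigraph T ∧
    tourRankLen n T r = m}

/-- `ℓ_max^Tour(n, r)`. -/
def lmaxTour (n r : ℕ) : ℕ :=
  sSup {m | ∃ T : Fin n → Fin n → Prop, IsTournament T ∧ IsStrongDigraph T ∧
    tourRankLen n T r = m}

theorem wordEval_append [DecidableEq V] (w₁ w₂ : List (V × V)) (x : V) :
    wordEval (w₁ ++ w₂) x = wordEval w₂ (wordEval w₁ x) := by
  simp [wordEval, List.foldl_append]

theorem wordEval_cons [DecidableEq V] (e : V × V) (w : List (V × V)) (x : V) :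
    wordEval (e :: w) x = wordEval w (arcMap e.1 e.2 x) := rfl

theorem wordEval_nil [DecidableEq V] (x : V) : wordEval ([] : List (V × V)) x = x := rfl

theorem arcLen_le_of_word [DecidableEq V] {D : V → V → Prop} {α : V → V} {w : List (V × V)}
    (hw : ∀ e ∈ w, D e.1 e.2) (h : wordEval w = α) : arcLen D α ≤ w.length :=
  Nat.sInf_le ⟨w, rfl, hw, h⟩

theorem le_arcLen [DecidableEq V] {D : V → V → Prop} {α : V → V} {m : ℕ}
    (hex : ∃ w : List (V × V), (∀ e ∈ w, D e.1 e.2) ∧ wordEval w = α)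
    (h : ∀ w : List (V × V), (∀ e ∈ w, D e.1 e.2) → wordEval w = α → m ≤ w.length) :
    m ≤ arcLen D α := by
  obtain ⟨w, hw, hα⟩ := hex
  refine le_csInf ⟨_, w, rfl, hw, hα⟩ ?_
  rintro k ⟨w₂, rfl, hw₂, hwα₂⟩
  exact h w₂ hw₂ hwα₂

/-! ### Arcs of the complete digraph as words along shortest paths -/

/-- There is a directed walk of length `k` from `u` to `v`. -/
def StepsTo (D : V → V → Prop) (k : ℕ) (u v : V) : Prop :=
  ∃ p : ℕ → V, p 0 = u ∧ p k = v ∧ ∀ i < k, D (p i) (p (i + 1))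

theorem StepsTo.trans {D : V → V → Prop} {k l : ℕ} {u v w : V} (h₁ : StepsTo D k u v)
    (h₂ : StepsTo D l v w) : StepsTo D (k + l) u w := by
  obtain ⟨p, hp0, hpk, hp⟩ := h₁
  obtain ⟨q, hq0, hql, hq⟩ := h₂
  refine ⟨fun m => if m ≤ k then p m else q (m - k), by simpa using hp0, ?_, ?_⟩
  · rcases Nat.eq_zero_or_pos l with rfl | hl
    · simp [hpk, ← hql, hq0]
    · have : ¬ k + l ≤ k := by omega
      simp [this, hql]
  · intro i hi
    rcases lt_trichotomy i k with h | rfl | h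
    · have h1 : i ≤ k := h.le
      have h2 : i + 1 ≤ k := h
      simpa [h1, h2] using hp i h
    · have h2 : ¬ i + 1 ≤ i := by omega
      have := hq 0 (by omega)
      simpa [hpk, ← hq0] using this
    · have h1 : ¬ i ≤ k := by omega
      have h2 : ¬ i + 1 ≤ k := by omega
      have h3 : i + 1 - k = i - k + 1 := by omega
      simpa only [h1, h2, if_false, h3] using hq (i - k) (by omega)

theorem stepsTo_one {D : V → V → Prop} {u v : V} (h : D u v) : StepsTo D 1 u v := by
  refine ⟨fun m => if m = 0 then u else v, by simp, by simp, fun i hi => ?_⟩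
  have : i = 0 := by omega
  simpa [this] using h

theorem exists_stepsTo {D : V → V → Prop} {u v : V} (h : Relation.ReflTransGen D u v) :
    ∃ k, StepsTo D k u v := by
  induction h with
  | refl => exact ⟨0, fun _ => u, rfl, rfl, by simp⟩
  | tail _ hbc ih =>
    obtain ⟨k, hk⟩ := ih
    exact ⟨k + 1, hk.trans (stepsTo_one hbc)⟩

theorem stepsTo_segment {D : V → V → Prop} {k : ℕ} {p : ℕ → V}
    (hp : ∀ i < k, D (p i) (p (i + 1))) {i j : ℕ} (hij : i ≤ j) (hj : j ≤ k) :
    StepsTo D (j - i) (p i) (p j) := by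
  refine ⟨fun m => p (i + m), rfl, ?_, fun m hm => hp (i + m) (by omega)⟩
  simp only
  congr 1
  omega

/-- In a tournament, a shortest walk is a path all of whose steps of length two are reversed
by an edge. -/
theorem exists_shortest_path {D : V → V → Prop} (hT : IsTournament D) {u v : V} {k : ℕ}
    (h : StepsTo D k u v) :
    ∃ l ≤ k, ∃ p : ℕ → V, p 0 = u ∧ p l = v ∧ (∀ i < l, D (p i) (p (i + 1))) ∧
      Set.InjOn p (Set.Iic l) ∧ ∀ i, i + 2 ≤ l → D (p (i + 2)) (p i) := by
  classical
  have hex : ∃ k, StepsTo D k u v := ⟨k, h⟩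
  obtain ⟨p, hp0, hpl, hp⟩ := Nat.find_spec hex
  set l := Nat.find hex with hl
  have hmin : ∀ m, StepsTo D m u v → l ≤ m := fun m hm => Nat.find_min' hex hm
  have hne : ∀ i j, i < j → j ≤ l → p i ≠ p j := by
    intro i j hij hj he
    have h1 := stepsTo_segment hp (Nat.zero_le i) (by omega)
    have h2 := stepsTo_segment hp hj le_rfl
    rw [← he] at h2
    have h3 := h1.trans h2
    rw [hp0, hpl] at h3
    have := hmin _ h3
    omega
  refine ⟨l, hmin k h, p, hp0, hpl, hp, ?_, ?_⟩
  · intro i hi j hj he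
    rcases lt_trichotomy i j with h | h | h
    · exact absurd he (hne i j h hj)
    · exact h
    · exact absurd he.symm (hne j i h hi)
  · intro i hi
    rcases (hT.2 (p i) (p (i + 2)) (hne i (i + 2) (by omega) hi)).1 with hd | hd
    · have h1 := stepsTo_segment hp (Nat.zero_le i) (by omega)
      have h2 := stepsTo_segment hp hi le_rfl
      have h3 := (h1.trans (stepsTo_one hd)).trans h2
      rw [hp0, hpl] at h3
      have := hmin _ h3
      omega
    · exact hd

theorem exists_stepsTo_lt_card [Fintype V] {D : V → V → Prop} (hT : IsTournament D)
    (hS : IsStrongDigraph D) (u v : V) : ∃ k ≤ Fintype.card V - 1, StepsTo D k u v := by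
  obtain ⟨k, hk⟩ := exists_stepsTo (hS u v)
  obtain ⟨l, -, p, hp0, hpl, hp, hinj, -⟩ := exists_shortest_path hT hk
  refine ⟨l, ?_, p, hp0, hpl, hp⟩
  have : Function.Injective (fun i : Fin (l + 1) => p i) := fun i j hij =>
    Fin.ext (hinj (Nat.lt_succ_iff.1 i.2) (Nat.lt_succ_iff.1 j.2) hij)
  have := Fintype.card_le_of_injective _ this
  simp at this
  omega

theorem exists_backshift_word [DecidableEq V] {D : V → V → Prop} {p : ℕ → V} (k : ℕ)
    (hp : ∀ i ≤ k, D (p i) (p (i + 1))) (hb : ∀ i < k, D (p (i + 2)) (p i))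
    (hinj : Set.InjOn p (Set.Iic (k + 1))) :
    ∃ w : List (V × V), w.length = 3 * k + 1 ∧ (∀ e ∈ w, D e.1 e.2) ∧
      wordEval w (p 0) = p (k + 1) ∧ (∀ i < k, wordEval w (p (i + 1)) = p i) ∧
      ∀ x, (∀ i ≤ k + 1, x ≠ p i) → wordEval w x = x := by
  induction k with
  | zero =>
    refine ⟨[(p 0, p 1)], rfl, by simpa using hp 0 le_rfl, ?_, by simp, ?_⟩
    · simp [wordEval, arcMap]
    · intro x hx
      simp [wordEval, arcMap, hx 0 (by omega)]
  | succ k ih =>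
    have hne : ∀ i j, i ≤ k + 2 → j ≤ k + 2 → i ≠ j → p i ≠ p j := fun i j hi hj hij he =>
      hij (hinj hi hj he)
    obtain ⟨w, hlen, hw, h0, hs, hf⟩ := ih (fun i hi => hp i (by omega))
      (fun i hi => hb i (by omega)) (hinj.mono (Set.Iic_subset_Iic.2 (by omega)))
    refine ⟨(p (k + 1), p (k + 2)) :: (w ++ [(p (k + 2), p k), (p (k + 1), p (k + 2))]),
      by simp [hlen]; omega, ?_, ?_, ?_, ?_⟩
    · intro e he
      simp only [List.mem_cons, List.mem_append, List.not_mem_nil, or_false] at he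
      rcases he with rfl | he | rfl | rfl
      · exact hp (k + 1) le_rfl
      · exact hw e he
      · exact hb k (by omega)
      · exact hp (k + 1) le_rfl
    · rw [wordEval_cons, wordEval_append]
      simp only [arcMap]
      rw [if_neg (hne 0 (k + 1) (by omega) (by omega) (by omega)), h0]
      simp [wordEval, arcMap, hne (k + 1) (k + 2) (by omega) (by omega) (by omega)]
    · intro i hi
      rw [wordEval_cons, wordEval_append]
      simp only [arcMap]
      rcases Nat.lt_succ_iff_lt_or_eq.1 hi with hik | rfl
      · rw [if_neg (hne (i + 1) (k + 1) (by omega) (by omega) (by omega)), hs i hik]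
        simp [wordEval, arcMap, hne i (k + 2) (by omega) (by omega) (by omega),
          hne i (k + 1) (by omega) (by omega) (by omega)]
      · rw [if_pos rfl, hf _ fun j hj => hne _ _ le_rfl (by omega) (by omega)]
        simp [wordEval, arcMap, hne i (i + 1) (by omega) (by omega) (by omega)]
    · intro x hx
      rw [wordEval_cons, wordEval_append]
      simp only [arcMap]
      rw [if_neg (hx (k + 1) (by omega)), hf x fun i hi => hx i (by omega)]
      simp [wordEval, arcMap, hx (k + 2) (by omega), hx (k + 1) (by omega)]

theorem exists_shift_word [DecidableEq V] {D : V → V → Prop} {p : ℕ → V} (k : ℕ)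
    (hp : ∀ i < k, D (p i) (p (i + 1))) (hinj : Set.InjOn p (Set.Iic k)) :
    ∃ w : List (V × V), w.length = k ∧ (∀ e ∈ w, D e.1 e.2) ∧
      (∀ i < k, wordEval w (p i) = p (i + 1)) ∧
      ∀ x, (∀ i < k, x ≠ p i) → wordEval w x = x := by
  induction k with
  | zero => exact ⟨[], rfl, by simp, by simp, fun x _ => rfl⟩
  | succ k ih =>
    have hne : ∀ i j, i ≤ k + 1 → j ≤ k + 1 → i ≠ j → p i ≠ p j := fun i j hi hj hij he =>
      hij (hinj hi hj he)
    obtain ⟨w, hlen, hw, hs, hf⟩ := ih (fun i hi => hp i (by omega))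
      (hinj.mono (Set.Iic_subset_Iic.2 (by omega)))
    refine ⟨(p k, p (k + 1)) :: w, by simp [hlen], ?_, ?_, ?_⟩
    · intro e he
      rcases List.mem_cons.1 he with rfl | he
      · exact hp k (by omega)
      · exact hw e he
    · intro i hi
      rw [wordEval_cons]
      simp only [arcMap]
      rcases Nat.lt_succ_iff_lt_or_eq.1 hi with hik | rfl
      · rw [if_neg (hne i k (by omega) (by omega) (by omega)), hs i hik]
      · rw [if_pos rfl, hf _ fun j hj => hne _ _ le_rfl (by omega) (by omega)]
    · intro x hx
      rw [wordEval_cons]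
      simp only [arcMap]
      rw [if_neg (hx k (by omega)), hf x fun i hi => hx i (by omega)]

/-- A token can hop from `u` to the unoccupied vertex `v` at distance at most `d`, all other
tokens being left in place, using at most `4d - 3` arcs. -/
theorem exists_hop_word [DecidableEq V] {D : V → V → Prop} (hT : IsTournament D) {d : ℕ}
    {u v : V} (huv : u ≠ v) (h : ∃ k ≤ d, StepsTo D k u v) :
    ∃ w : List (V × V), w.length ≤ 4 * d - 3 ∧ (∀ e ∈ w, D e.1 e.2) ∧
      ∀ x, x ≠ v → wordEval w x = arcMap u v x := by
  obtain ⟨k, hkd, hk⟩ := h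
  obtain ⟨l, hlk, p, hp0, hpl, hp, hinj, hb⟩ := exists_shortest_path hT hk
  obtain _ | l := l
  · exact absurd (hp0.symm.trans hpl) huv
  have hne : ∀ i j, i ≤ l + 1 → j ≤ l + 1 → i ≠ j → p i ≠ p j := fun i j hi hj hij he =>
    hij (hinj hi hj he)
  obtain ⟨w₁, hlen₁, hw₁, h0₁, hs₁, hf₁⟩ := exists_backshift_word l
    (fun i hi => hp i (by omega)) (fun i hi => hb i (by omega)) hinj
  obtain ⟨w₂, hlen₂, hw₂, hs₂, hf₂⟩ := exists_shift_word l
    (fun i hi => hp i (by omega)) (hinj.mono (Set.Iic_subset_Iic.2 (by omega)))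
  refine ⟨w₁ ++ w₂, by rw [List.length_append]; omega, ?_, ?_⟩
  · intro e he
    rcases List.mem_append.1 he with he | he
    exacts [hw₁ e he, hw₂ e he]
  · intro x hx
    rw [wordEval_append]
    by_cases hxp : ∃ i ≤ l + 1, x = p i
    · obtain ⟨i, hi, rfl⟩ := hxp
      obtain _ | i := i
      · rw [h0₁, hf₂ _ fun i hi => hne _ _ le_rfl (by omega) (by omega), hp0, hpl]
        simp [arcMap]
      · have hil : i < l := by
          by_contra hil
          obtain rfl : i = l := by omega
          exact hx hpl
        rw [hs₁ i hil, hs₂ i hil, arcMap, if_neg]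
        rw [← hp0]
        exact hne _ _ hi (by omega) (by omega)
    · push Not at hxp
      rw [hf₁ x hxp, hf₂ x fun i hi => hxp i (by omega), arcMap, if_neg]
      rw [← hp0]
      exact hxp 0 (by omega)

/-! ### Upper bound -/

theorem exists_collapse_word [Fintype V] [DecidableEq V] {D : V → V → Prop}
    (hT : IsTournament D) (α : V → V) (m : ℕ) :
    ∀ β : V → V, (∀ x y, β x = β y → α x = α y) → (Finset.univ.image β).card = m →
      ∃ w : List (V × V), w.length + (Finset.univ.image α).card ≤ m ∧ (∀ e ∈ w, D e.1 e.2) ∧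
        ∀ x y, wordEval w (β x) = wordEval w (β y) ↔ α x = α y := by
  induction m using Nat.strong_induction_on with
  | _ m ih =>
    intro β hβ hm
    by_cases hker : ∀ x y, α x = α y → β x = β y
    · refine ⟨[], ?_, by simp, fun x y => ⟨hβ x y, hker x y⟩⟩
      have hfac : Function.FactorsThrough α β := fun x y h => hβ x y h
      have : Finset.univ.image α
          = (Finset.univ.image β).image (Function.extend β α id) := by
        rw [Finset.image_image]
        congr 1
        funext x
        exact (hfac.extend_apply id x).symm
      rw [this, List.length_nil, Nat.zero_add, ← hm]
      exact Finset.card_image_le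
    · obtain ⟨x, y, hα, hne, hd⟩ : ∃ x y, α x = α y ∧ β x ≠ β y ∧ D (β x) (β y) := by
        push Not at hker
        obtain ⟨x, y, hα, hne⟩ := hker
        rcases (hT.2 _ _ hne).1 with hd | hd
        · exact ⟨x, y, hα, hne, hd⟩
        · exact ⟨y, x, hα.symm, hne.symm, hd⟩
      set γ : V → V := fun z => arcMap (β x) (β y) (β z) with hγ
      have hsub : Finset.univ.image γ ⊆ (Finset.univ.image β).erase (β x) := by
        intro z hz
        obtain ⟨t, -, rfl⟩ := Finset.mem_image.1 hz
        simp only [hγ, arcMap]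
        split_ifs with h
        · simp [hne.symm]
        · simp [h]
      have hcard := Finset.card_le_card hsub
      rw [Finset.card_erase_of_mem (Finset.mem_image_of_mem _ (Finset.mem_univ x)), hm] at hcard
      have hpos : 0 < m := by
        rw [← hm]
        exact Finset.card_pos.2 ⟨β x, Finset.mem_image_of_mem _ (Finset.mem_univ x)⟩
      have hγα : ∀ s t, γ s = γ t → α s = α t := by
        intro s t hst
        simp only [hγ, arcMap] at hst
        split_ifs at hst with h1 h2 h2
        · exact hβ _ _ (h1.trans h2.symm)
        · rw [hβ _ _ h1, hα, hβ _ _ hst]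
        · rw [hβ _ _ h2, hα, hβ _ _ hst]
        · exact hβ _ _ hst
      obtain ⟨w, hlen, hw, hk⟩ := ih _ (by omega) γ hγα rfl
      refine ⟨(β x, β y) :: w, by rw [List.length_cons]; omega, ?_, hk⟩
      intro e he
      rcases List.mem_cons.1 he with rfl | he
      exacts [hd, hw e he]

/-- A digraph allowing hops of cost at most `c` can rearrange tokens, with
`x i` the current and `y i` the desired position of token `i`. -/
theorem exists_rearrange_word [Fintype V] [DecidableEq V] {ι : Type*} [Fintype ι]
    [DecidableEq ι] {D : V → V → Prop} {c : ℕ}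
    (hop : ∀ u v, u ≠ v → ∃ w : List (V × V), w.length ≤ c ∧ (∀ e ∈ w, D e.1 e.2) ∧
      ∀ x, x ≠ v → wordEval w x = arcMap u v x)
    (hcard : Fintype.card ι < Fintype.card V) {y : ι → V} (hy : Function.Injective y) (m : ℕ) :
    ∀ x : ι → V, Function.Injective x → (Finset.univ.filter fun i => x i ≠ y i).card = m →
      ∃ w : List (V × V), 2 * w.length ≤ 3 * m * c ∧ (∀ e ∈ w, D e.1 e.2) ∧
        ∀ i, wordEval w (x i) = y i := by
  have move : ∀ (x : ι → V), Function.Injective x → ∀ i v, (∀ j, x j ≠ v) →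
      Function.Injective (Function.update x i v) ∧
      ∃ w : List (V × V), w.length ≤ c ∧ (∀ e ∈ w, D e.1 e.2) ∧
        ∀ j, wordEval w (x j) = Function.update x i v j := by
    intro x hx i v hv
    constructor
    · intro s t hst
      simp only [Function.update_apply] at hst
      split_ifs at hst with h1 h2 h2
      · rw [h1, h2]
      · exact absurd hst.symm (hv t)
      · exact absurd hst (hv s)
      · exact hx hst
    · obtain ⟨w, hlen, hw, h⟩ := hop (x i) v (hv i)
      refine ⟨w, hlen, hw, fun j => ?_⟩
      rw [h _ (hv j), Function.update_apply, arcMap]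
      simp only [hx.eq_iff]
  induction m using Nat.strong_induction_on with
  | _ m ih =>
    intro x hx hm
    by_cases hA : ∃ i, x i ≠ y i ∧ ∀ j, x j ≠ y i
    · obtain ⟨i, hi, hfree⟩ := hA
      obtain ⟨hx', w, hlen, hw, hwx⟩ := move x hx i (y i) hfree
      have hsub : (Finset.univ.filter fun j => Function.update x i (y i) j ≠ y j)
          ⊆ (Finset.univ.filter fun j => x j ≠ y j).erase i := by
        intro j hj
        by_cases hji : j = i
        · subst hji; simp at hj
        · simpa [hji] using hj
      have hc := Finset.card_le_card hsub
      rw [Finset.card_erase_of_mem (by simpa using hi), hm] at hc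
      have hpos : 0 < m := hm ▸ Finset.card_pos.2 ⟨i, by simpa using hi⟩
      obtain ⟨w', hlen', hw', hwx'⟩ := ih _ (by omega) _ hx' rfl
      refine ⟨w ++ w', ?_, ?_, ?_⟩
      · rw [List.length_append]
        have : 3 * (Finset.univ.filter fun j => Function.update x i (y i) j ≠ y j).card * c
            ≤ 3 * (m - 1) * c := by gcongr
        obtain ⟨m, rfl⟩ : ∃ k, m = k + 1 := ⟨m - 1, by omega⟩
        simp only [Nat.add_sub_cancel] at this
        linarith
      · intro e he
        rcases List.mem_append.1 he with he | he
        exacts [hw e he, hw' e he]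
      · intro j
        rw [wordEval_append, hwx, hwx']
    · push Not at hA
      by_cases hall : ∀ i, x i = y i
      · exact ⟨[], by simp, by simp, hall⟩
      push Not at hall
      obtain ⟨i, hi⟩ := hall
      obtain ⟨h, hh⟩ : ∃ h, ∀ j, x j ≠ h := by
        by_contra! hsurj
        exact absurd (Fintype.card_le_of_surjective x hsurj) (by omega)
      obtain ⟨t, ht⟩ := hA i hi
      have hti : t ≠ i := by rintro rfl; exact hi ht
      have hty : x t ≠ y t := fun he => hti (hy (he.symm.trans ht))
      set U := Finset.univ.filter fun j => x j ≠ y j with hU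
      have himg : U.image y = U.image x := by
        apply Finset.eq_of_subset_of_card_le
        · intro z hz
          obtain ⟨j, hj, rfl⟩ := Finset.mem_image.1 hz
          have hj' : x j ≠ y j := by simpa [hU] using hj
          obtain ⟨s, hs⟩ := hA j hj'
          refine Finset.mem_image.2 ⟨s, ?_, hs⟩
          simp only [hU, Finset.mem_filter, Finset.mem_univ, true_and]
          intro he
          have := hy (he.symm.trans hs)
          subst this
          exact hj' hs
        · rw [Finset.card_image_of_injective _ hx, Finset.card_image_of_injective _ hy]
      obtain ⟨s, hsU, hs⟩ : ∃ s ∈ U, y s = x i := by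
        have : x i ∈ U.image y := by
          rw [himg]
          exact Finset.mem_image_of_mem _ (by simpa [hU] using hi)
        exact Finset.mem_image.1 this
      have hsi : s ≠ i := by rintro rfl; exact hi hs.symm
      obtain ⟨hx₁, w₁, hlen₁, hw₁, hwx₁⟩ := move x hx t h hh
      obtain ⟨hx₂, w₂, hlen₂, hw₂, hwx₂⟩ := move _ hx₁ i (y i) (by
        intro j
        rw [Function.update_apply]
        split_ifs with hj
        · rw [← ht]; exact (hh t).symm
        · rw [← ht]; exact fun he => hj (hx he))
      obtain ⟨hx₃, w₃, hlen₃, hw₃, hwx₃⟩ := move _ hx₂ s (y s) (by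
        intro j
        rw [Function.update_apply, Function.update_apply, hs]
        split_ifs with hj hj'
        · exact hi.symm
        · exact (hh i).symm
        · exact fun he => hj (hx he))
      set x₃ := Function.update (Function.update (Function.update x t h) i (y i)) s (y s)
        with hx₃def
      have hsub : (Finset.univ.filter fun j => x₃ j ≠ y j) ⊆ (U.erase i).erase s := by
        intro j hj
        simp only [Finset.mem_filter, Finset.mem_univ, true_and, hx₃def,
          Function.update_apply] at hj
        simp only [Finset.mem_erase, hU, Finset.mem_filter, Finset.mem_univ, true_and]
        split_ifs at hj with h1 h2 h3
        · exact absurd (h1 ▸ rfl) hj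
        · exact absurd (h2 ▸ rfl) hj
        · exact ⟨h1, h2, h3 ▸ hty⟩
        · exact ⟨h1, h2, hj⟩
      have hiU : i ∈ U := by simpa [hU] using hi
      have hc := Finset.card_le_card hsub
      have hsU' : s ∈ U.erase i := Finset.mem_erase.2 ⟨hsi, hsU⟩
      have hpos : 0 < (U.erase i).card := Finset.card_pos.2 ⟨s, hsU'⟩
      rw [Finset.card_erase_of_mem hsU'] at hc
      rw [Finset.card_erase_of_mem hiU, hm] at hc hpos
      obtain ⟨w₄, hlen₄, hw₄, hwx₄⟩ := ih _ (by omega) _ hx₃ rfl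
      refine ⟨w₁ ++ (w₂ ++ (w₃ ++ w₄)), ?_, ?_, ?_⟩
      · simp only [List.length_append]
        have : 3 * (Finset.univ.filter fun j => x₃ j ≠ y j).card * c
            ≤ 3 * (m - 1 - 1) * c := by gcongr
        obtain ⟨m, rfl⟩ : ∃ k, m = k + 2 := ⟨m - 2, by omega⟩
        have h2 : m + 2 - 1 - 1 = m := by omega
        rw [h2] at this
        linarith
      · intro e he
        simp only [List.mem_append] at he
        rcases he with he | he | he | he
        exacts [hw₁ e he, hw₂ e he, hw₃ e he, hw₄ e he]
      · intro j
        rw [wordEval_append, wordEval_append, wordEval_append, hwx₁, hwx₂, hwx₃, hwx₄]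

theorem rnk_eq_card_image [Fintype V] [DecidableEq V] (α : V → V) :
    rnk α = (Finset.univ.image α).card := by
  rw [rnk, ← Set.ncard_coe_finset]
  simp

/-- In a tournament of diameter at most `d`, a singular map of rank `r` is a product of at most
`n - r + (3r / 2)(4d - 3)` arcs. -/
theorem exists_word_of_diameter_le [Fintype V] [DecidableEq V] {D : V → V → Prop}
    (hT : IsTournament D) {d : ℕ} (hd : ∀ u v, ∃ k ≤ d, StepsTo D k u v) (α : V → V)
    (hα : rnk α < Fintype.card V) :
    ∃ w : List (V × V), (∀ e ∈ w, D e.1 e.2) ∧ wordEval w = α ∧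
      2 * (w.length + rnk α) ≤ 2 * Fintype.card V + 3 * rnk α * (4 * d - 3) := by
  obtain ⟨w₁, hlen₁, hw₁, hk₁⟩ := exists_collapse_word hT α _ id (fun x y h => congrArg α h) rfl
  have hinv : ∀ i : Set.range α, α i.2.choose = i := fun i => i.2.choose_spec
  have hr : Fintype.card (Set.range α) = rnk α := by
    rw [rnk, ← Nat.card_coe_set_eq, Nat.card_eq_fintype_card]
  obtain ⟨w₂, hlen₂, hw₂, hx₂⟩ := exists_rearrange_word (ι := Set.range α)
    (fun u v huv => exists_hop_word hT huv (hd u v)) (by rw [hr]; exact hα)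
    (y := Subtype.val) Subtype.val_injective _ (fun i => wordEval w₁ i.2.choose)
    (fun i j hij => Subtype.ext (by
      rw [← hinv i, ← hinv j]
      exact (hk₁ _ _).1 hij)) rfl
  refine ⟨w₁ ++ w₂, ?_, ?_, ?_⟩
  · intro e he
    rcases List.mem_append.1 he with he | he
    exacts [hw₁ e he, hw₂ e he]
  · funext v
    have : wordEval w₁ v = wordEval w₁ (⟨α v, v, rfl⟩ : Set.range α).2.choose :=
      (hk₁ _ _).2 (hinv ⟨α v, v, rfl⟩).symm
    rw [wordEval_append, this, hx₂ ⟨α v, v, rfl⟩]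
  · have h1 : w₁.length + rnk α ≤ Fintype.card V := by
      rw [rnk_eq_card_image]
      simpa using hlen₁
    have h2 : 2 * w₂.length ≤ 3 * rnk α * (4 * d - 3) := by
      refine hlen₂.trans ?_
      gcongr
      rw [← hr]
      exact Finset.card_le_univ _
    rw [List.length_append]
    omega

/-! ### Lower bounds -/

theorem sum_le_sum_add_one {ι : Type*} [Fintype ι] (f g : ι → ℤ) (h : ∀ j, f j ≤ g j + 1)
    (hs : ∀ i j, g i < f i → g j < f j → i = j) : ∑ j, f j ≤ ∑ j, g j + 1 := by
  classical
  by_cases hex : ∃ i, g i < f i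
  · obtain ⟨i, hi⟩ := hex
    have h1 : ∀ j ∈ Finset.univ, f j ≤ g j + if j = i then 1 else 0 := by
      intro j _
      split_ifs with hj
      · exact h j
      · have : ¬ g j < f j := fun hlt => hj (hs j i hlt hi)
        omega
    refine (Finset.sum_le_sum h1).trans ?_
    rw [Finset.sum_add_distrib]
    simp
  · push Not at hex
    have := Finset.sum_le_sum fun j (_ : j ∈ Finset.univ) => hex j
    omega

/-- A potential, given by terms of which at most one decreases at each arc, and by at most one,
bounds from below the length of a word expressing `α`. -/
theorem potential_le_length [DecidableEq V] {ι : Type*} [Fintype ι] {D : V → V → Prop}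
    {α : V → V} (φ : ι → (V → V) → ℤ) (hα : ∀ j, φ j α ≤ 0)
    (hle : ∀ β a b, D a b → ∀ j, φ j β ≤ φ j (arcMap a b ∘ β) + 1)
    (hsub : ∀ β a b, D a b → (∀ x y, β x = β y → α x = α y) →
      ∀ i j, φ i (arcMap a b ∘ β) < φ i β → φ j (arcMap a b ∘ β) < φ j β → i = j)
    {w : List (V × V)} (hw : ∀ e ∈ w, D e.1 e.2) (hwα : wordEval w = α) :
    ∑ j, φ j id ≤ w.length := by
  suffices H : ∀ (w : List (V × V)) (β : V → V), (∀ e ∈ w, D e.1 e.2) →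
      (∀ x, wordEval w (β x) = α x) → ∑ j, φ j β ≤ w.length from
    H w id hw fun x => congrFun hwα x
  clear hwα hw w
  intro w
  induction w with
  | nil =>
    intro β _ hβ
    have : β = α := funext hβ
    subst this
    simpa using Finset.sum_nonpos fun j _ => hα j
  | cons e w ih =>
    intro β hw hβ
    have hD := hw e (by simp)
    have h1 := ih (arcMap e.1 e.2 ∘ β) (fun e' he' => hw e' (by simp [he'])) hβ
    have h2 := sum_le_sum_add_one (fun j => φ j β) (fun j => φ j (arcMap e.1 e.2 ∘ β))
      (hle β _ _ hD) (hsub β _ _ hD fun x y hxy => by rw [← hβ x, ← hβ y, hxy])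
    rw [List.length_cons]
    push_cast
    omega

theorem exists_insert_isChain {D : V → V → Prop} (hT : IsTournament D) (v : V) (l : List V)
    (hl : l.IsChain D) (hv : v ∉ l) :
    ∃ l' : List V, l'.Perm (v :: l) ∧ l'.IsChain D ∧
      (l'.head? = some v ∨ l'.head? = l.head?) := by
  induction l with
  | nil => exact ⟨[v], List.Perm.refl _, by simp, Or.inl rfl⟩
  | cons a t ih =>
    have hva : v ≠ a := fun h => hv (by simp [h])
    rcases (hT.2 v a hva).1 with hd | hd
    · exact ⟨v :: a :: t, List.Perm.refl _, List.isChain_cons_cons.2 ⟨hd, hl⟩, Or.inl rfl⟩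
    · rw [List.isChain_cons] at hl
      obtain ⟨l', hp, hc, hh⟩ := ih hl.2 fun h => hv (by simp [h])
      refine ⟨a :: l', (hp.cons a).trans (List.Perm.swap v a t), ?_, Or.inr rfl⟩
      rw [List.isChain_cons]
      refine ⟨fun y hy => ?_, hc⟩
      rcases hh with hh | hh
      · rw [hh, Option.mem_some_iff] at hy
        exact hy ▸ hd
      · exact hl.1 y (hh ▸ hy)

/-- Every finite tournament has a Hamiltonian path. -/
theorem exists_hamiltonian_path [Fintype V] {D : V → V → Prop} (hT : IsTournament D) :
    ∃ l : List V, l.Nodup ∧ (∀ x, x ∈ l) ∧ l.IsChain D := by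
  classical
  suffices H : ∀ s : Finset V, ∃ l : List V, l.Nodup ∧ (∀ x, x ∈ l ↔ x ∈ s) ∧ l.IsChain D by
    obtain ⟨l, h1, h2, h3⟩ := H Finset.univ
    exact ⟨l, h1, by simpa using h2, h3⟩
  intro s
  induction s using Finset.induction_on with
  | empty => exact ⟨[], by simp, by simp, by simp⟩
  | insert v s hv ih =>
    obtain ⟨l, h1, h2, h3⟩ := ih
    have hvl : v ∉ l := fun h => hv ((h2 v).1 h)
    obtain ⟨l', hp, hc, -⟩ := exists_insert_isChain hT v l h3 hvl
    refine ⟨l', hp.nodup_iff.2 (List.nodup_cons.2 ⟨hvl, h1⟩), fun x => ?_, hc⟩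
    rw [hp.mem_iff, List.mem_cons, h2, Finset.mem_insert]

theorem exists_hamiltonian_equiv {n : ℕ} {T : Fin n → Fin n → Prop} (hT : IsTournament T) :
    ∃ e : Fin n ≃ Fin n, ∀ i j : Fin n, (j : ℕ) = i + 1 → T (e i) (e j) := by
  obtain ⟨l, hnd, hmem, hc⟩ := exists_hamiltonian_path hT
  have hlen : l.length = n := by
    have h1 : l.toFinset = Finset.univ := Finset.eq_univ_iff_forall.2 fun x => by simp [hmem]
    have h2 := List.toFinset_card_of_nodup hnd
    rw [h1] at h2
    simpa using h2.symm
  refine ⟨(finCongr hlen.symm).trans (List.Nodup.getEquivOfForallMemList l hnd hmem),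
    fun i j hij => ?_⟩
  have := List.isChain_iff_getElem.1 hc i (by omega)
  simpa [List.Nodup.getEquivOfForallMemList, hij] using this

theorem bddAbove_arcLen (n r : ℕ) (T : Fin n → Fin n → Prop) :
    BddAbove {k | ∃ α : Fin n → Fin n, ¬ Function.Bijective α ∧ rnk α = r ∧ arcLen T α = k} :=
  ((Set.finite_range (arcLen T)).subset (by rintro k ⟨α, -, -, rfl⟩; exact ⟨α, rfl⟩)).bddAbove

theorem bddAbove_tourRankLen (n r : ℕ) :
    BddAbove {m | ∃ T : Fin n → Fin n → Prop, IsTournament T ∧ IsStrongDigraph T ∧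
      tourRankLen n T r = m} :=
  ((Set.finite_range fun T : Fin n → Fin n → Prop => tourRankLen n T r).subset
    (by rintro k ⟨T, -, -, rfl⟩; exact ⟨T, rfl⟩)).bddAbove

theorem arcLen_le_tourRankLen {n r : ℕ} {T : Fin n → Fin n → Prop} {α : Fin n → Fin n}
    (hα : rnk α = r) (hr : r < n) : arcLen T α ≤ tourRankLen n T r := by
  refine le_csSup (bddAbove_arcLen n r T) ⟨α, fun hb => ?_, hα, rfl⟩
  rw [rnk, hb.surjective.range_eq, Set.ncard_univ, Nat.card_eq_fintype_card,
    Fintype.card_fin] at hα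
  omega

theorem exists_word_of_strong {n : ℕ} {T : Fin n → Fin n → Prop} (hT : IsTournament T)
    (hS : IsStrongDigraph T) {α : Fin n → Fin n} (hα : rnk α < n) :
    ∃ w : List (Fin n × Fin n), (∀ e ∈ w, T e.1 e.2) ∧ wordEval w = α := by
  obtain ⟨w, h1, h2, -⟩ := exists_word_of_diameter_le hT (exists_stepsTo_lt_card hT hS) α
    (by simpa using hα)
  exact ⟨w, h1, h2⟩

theorem tourRankLen_le_of_diameter_le {n r d : ℕ} (hr : r < n) {T : Fin n → Fin n → Prop}
    (hT : IsTournament T) (hd : ∀ u v, ∃ k ≤ d, StepsTo T k u v) :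
    2 * (tourRankLen n T r + r) ≤ 2 * n + 3 * r * (4 * d - 3) := by
  have : tourRankLen n T r ≤ (2 * n + 3 * r * (4 * d - 3)) / 2 - r := by
    refine csSup_le' ?_
    rintro k ⟨α, -, rfl, rfl⟩
    obtain ⟨w, hw, hwα, hlen⟩ := exists_word_of_diameter_le hT hd α (by simpa using hr)
    rw [Fintype.card_fin] at hlen
    have := arcLen_le_of_word hw hwα
    omega
  have h2 : r ≤ n + 3 * r * (4 * d - 3) / 2 := by omega
  omega

theorem le_tourRankLen {n r : ℕ} (hr1 : 2 ≤ r) (hr2 : r < n) {T : Fin n → Fin n → Prop}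
    (hT : IsTournament T) (hS : IsStrongDigraph T) : n + r - 1 ≤ tourRankLen n T r := by
  obtain ⟨e, he⟩ := exists_hamiltonian_equiv hT
  let a : Fin n → Fin n := fun i =>
    if 1 ≤ (i : ℕ) ∧ (i : ℕ) ≤ r then ⟨i - 1, by omega⟩ else ⟨r - 1, by omega⟩
  have ha : ∀ i, (a i : ℕ) = if 1 ≤ (i : ℕ) ∧ (i : ℕ) ≤ r then (i : ℕ) - 1 else r - 1 := by
    intro i
    simp only [a]
    split_ifs <;> rfl
  let α : Fin n → Fin n := fun x => e (a (e.symm x))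
  have hfix : ∀ x, α x ≠ x := by
    intro x hx
    have h1 : a (e.symm x) = e.symm x := e.injective (by simpa using hx)
    have h2 := ha (e.symm x)
    rw [h1] at h2
    split_ifs at h2 <;> omega
  have hα : rnk α = r := by
    have : Set.range α = Set.range fun t : Fin r => e ⟨t, by omega⟩ := by
      ext z
      constructor
      · rintro ⟨x, rfl⟩
        refine ⟨⟨a (e.symm x), ?_⟩, rfl⟩
        rw [ha]
        split_ifs <;> omega
      · rintro ⟨t, rfl⟩
        refine ⟨e ⟨t + 1, by omega⟩, ?_⟩
        simp only [α, Equiv.symm_apply_apply]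
        congr 1
        apply Fin.ext
        rw [ha, if_pos ⟨by simp, by simp⟩]
        simp
    rw [rnk, this, ← Set.image_univ, Set.ncard_image_of_injective]
    · simp [Set.ncard_univ]
    · intro s t hst
      have := e.injective hst
      simpa [Fin.ext_iff] using this
  refine le_trans ?_ (arcLen_le_tourRankLen hα hr2)
  refine le_arcLen (exists_word_of_strong hT hS (by omega)) fun w hw hwα => ?_
  let src : Fin (r - 1) → Fin n := fun t => e ⟨t + 1, by omega⟩
  let tgt : Fin (r - 1) → Fin n := fun t => e ⟨t, by omega⟩
  have hsrc : ∀ t, α (src t) = tgt t := by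
    intro t
    simp only [α, src, tgt, Equiv.symm_apply_apply]
    congr 1
    apply Fin.ext
    rw [ha, if_pos ⟨by simp, by simp; omega⟩]
    simp
  have hpre : ∀ t x, α x = tgt t → x = src t := by
    intro t x hx
    have h1 : a (e.symm x) = ⟨t, by omega⟩ := e.injective hx
    have h2 := ha (e.symm x)
    rw [h1] at h2
    simp only at h2
    have h3 : e.symm x = ⟨t + 1, by omega⟩ := by
      apply Fin.ext
      simp only
      split_ifs at h2 <;> omega
    simp only [src]
    rw [← h3, Equiv.apply_symm_apply]
  have htgt : Function.Injective tgt := by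
    intro s t hst
    have := e.injective hst
    simpa [Fin.ext_iff] using this
  have hedge : ∀ t, ¬ T (src t) (tgt t) := fun t h =>
    (hT.2 (tgt t) (src t) (fun h' => hT.1 (src t) (h' ▸ h))).2 ⟨he _ _ rfl, h⟩
  let φ : Fin n ⊕ Fin (r - 1) → (Fin n → Fin n) → ℤ := fun j β =>
    Sum.elim (fun x => if β x = x then 1 else 0)
      (fun t => if β (src t) = tgt t then 0 else 1) j
  have hmain := potential_le_length (D := T) (α := α) φ ?_ ?_ ?_ hw hwα
  · have h2 : ∀ t, src t ≠ tgt t := fun t h => hfix (src t) ((hsrc t).trans h.symm)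
    simp [φ, h2] at hmain
    omega
  · rintro (x | t)
    · simp [φ, hfix]
    · simp [φ, hsrc]
  · rintro β a b - (x | t)
    · simp only [φ, Sum.elim_inl]
      split_ifs <;> simp
    · simp only [φ, Sum.elim_inr]
      split_ifs <;> simp
  · intro β a b hab hker
    have hl : ∀ x, φ (Sum.inl x) (arcMap a b ∘ β) < φ (Sum.inl x) β → x = a ∧ β x = a := by
      intro x hx
      simp only [φ, Sum.elim_inl] at hx
      have h2 : β x = x := by
        by_contra h2
        rw [if_neg h2] at hx
        split_ifs at hx <;> omega
      have h1 : β x = a := by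
        by_contra h1
        have : (arcMap a b ∘ β) x = β x := if_neg h1
        rw [if_pos h2, if_pos (this.trans h2)] at hx
        exact lt_irrefl _ hx
      exact ⟨h2.symm.trans h1, h1⟩
    have hr : ∀ t, φ (Sum.inr t) (arcMap a b ∘ β) < φ (Sum.inr t) β →
        β (src t) = a ∧ tgt t = b := by
      intro t ht
      simp only [φ, Sum.elim_inr] at ht
      have h1 : (arcMap a b ∘ β) (src t) = tgt t := by
        by_contra h1
        rw [if_neg h1] at ht
        split_ifs at ht <;> omega
      have h2 : β (src t) = a := by
        by_contra h2
        have : (arcMap a b ∘ β) (src t) = β (src t) := if_neg h2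
        rw [if_pos h1, if_pos (this.symm.trans h1)] at ht
        exact lt_irrefl _ ht
      exact ⟨h2, h1.symm.trans (if_pos h2)⟩
    have hlr : ∀ x t, (x = a ∧ β x = a) → (β (src t) = a ∧ tgt t = b) → False := by
      rintro x t ⟨hxa, hx⟩ ⟨ht, htb⟩
      have h1 := hpre t x ((hker _ _ (hx.trans ht.symm)).trans (hsrc t))
      apply hedge t
      rwa [← h1, hxa, htb]
    rintro (x | t) (x' | t') h h'
    · rw [(hl x h).1, (hl x' h').1]
    · exact (hlr x t' (hl x h) (hr t' h')).elim
    · exact (hlr x' t (hl x' h') (hr t h)).elim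
    · rw [htgt ((hr t h).2.trans (hr t' h').2.symm)]

/-! ### A tournament of small diameter and a tournament of large diameter -/

/-- The circulant tournament on `2m + 1` vertices: `i → i + 1, …, i + m`. -/
def circulantTour (n m : ℕ) : Fin n → Fin n → Prop := fun i j =>
  ((i : ℕ) < j ∧ (j : ℕ) ≤ i + m) ∨ ((j : ℕ) + m < i)

theorem isTournament_circulantTour (n m : ℕ) : IsTournament (circulantTour n m) := by
  refine ⟨fun v => ?_, fun u v huv => ?_⟩
  · simp only [circulantTour]
    omega
  · have : (u : ℕ) ≠ v := fun h => huv (Fin.ext h)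
    simp only [circulantTour]
    omega

theorem circulantTour_diameter {n m : ℕ} (hm : 1 ≤ m) (hn : n = 2 * m + 1) (u v : Fin n) :
    ∃ k ≤ 2, StepsTo (circulantTour n m) k u v := by
  by_cases huv : u = v
  · exact ⟨0, by omega, fun _ => u, rfl, huv, by simp⟩
  have huv' : (u : ℕ) ≠ v := fun h => huv (Fin.ext h)
  by_cases hd : circulantTour n m u v
  · exact ⟨1, by omega, stepsTo_one hd⟩
  obtain ⟨w, h1, h2⟩ : ∃ w, circulantTour n m u w ∧ circulantTour n m w v := by
    simp only [circulantTour] at hd ⊢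
    by_cases hw : (u : ℕ) + m < n
    · exact ⟨⟨u + m, hw⟩, by simp only; omega, by simp only; omega⟩
    · exact ⟨⟨u - m - 1, by omega⟩, by simp only; omega, by simp only; omega⟩
  exact ⟨2, le_rfl, (stepsTo_one h1).trans (stepsTo_one h2)⟩

theorem StepsTo.reflTransGen {D : V → V → Prop} {k : ℕ} {u v : V} (h : StepsTo D k u v) :
    Relation.ReflTransGen D u v := by
  obtain ⟨p, rfl, rfl, hp⟩ := h
  induction k with
  | zero => exact .refl
  | succ k ih => exact (ih fun i hi => hp i (by omega)).tail (hp k (by omega))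

/-- The tournament with edges `i → i + 1` and `j → i` for `j ≥ i + 2`. -/
def pathTour (n : ℕ) : Fin n → Fin n → Prop := fun i j =>
  (j : ℕ) = i + 1 ∨ (j : ℕ) + 2 ≤ i

theorem isTournament_pathTour (n : ℕ) : IsTournament (pathTour n) := by
  refine ⟨fun v => ?_, fun u v huv => ?_⟩
  · simp only [pathTour]
    omega
  · have : (u : ℕ) ≠ v := fun h => huv (Fin.ext h)
    simp only [pathTour]
    omega

theorem isStrongDigraph_pathTour {n : ℕ} (hn : 3 ≤ n) : IsStrongDigraph (pathTour n) := by
  have up : ∀ k (u v : Fin n), (v : ℕ) = u + k → Relation.ReflTransGen (pathTour n) u v := by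
    intro k
    induction k with
    | zero => intro u v h; rw [Fin.ext (h.trans (Nat.add_zero _))]
    | succ k ih =>
      intro u v h
      exact (ih u ⟨u + k, by omega⟩ rfl).tail (Or.inl (by simp only; omega))
  intro u v
  have h1 := up (n - 1 - u) u ⟨n - 1, by omega⟩ (by simp only; omega)
  have h2 := up v ⟨0, by omega⟩ v (by simp)
  have h3 : pathTour n ⟨n - 1, by omega⟩ ⟨0, by omega⟩ := Or.inr (by simp only; omega)
  exact (h1.tail h3).trans h2

theorem le_tourRankLen_pathTour {n r s : ℕ} (hn : 3 ≤ n) (hr : r < n) (hs1 : 1 ≤ s)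
    (hsr : s < r) :
    (s + 1) * (n - s) ≤ tourRankLen n (pathTour n) r := by
  let α : Fin n → Fin n := fun x =>
    if (x : ℕ) < s then ⟨(x + (n - s)) % n, Nat.mod_lt _ (by omega)⟩
    else ⟨min (x - s) (r - s - 1), by omega⟩
  have hα₁ : ∀ x : Fin n, (x : ℕ) < s → (α x : ℕ) = x + (n - s) := by
    intro x hx
    simp only [α, if_pos hx]
    exact Nat.mod_eq_of_lt (by omega)
  have hα₂ : ∀ x : Fin n, ¬ (x : ℕ) < s → (α x : ℕ) = min (x - s) (r - s - 1) := by
    intro x hx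
    simp only [α, if_neg hx]
  have hrank : rnk α = r := by
    have : Set.range α = Set.range fun t : Fin r =>
        (⟨if (t : ℕ) < r - s then t else n - r + t, by split_ifs <;> omega⟩ : Fin n) := by
      ext z
      constructor
      · rintro ⟨x, rfl⟩
        by_cases hx : (x : ℕ) < s
        · refine ⟨⟨r - s + x, by omega⟩, Fin.ext ?_⟩
          rw [hα₁ x hx]
          simp only
          split_ifs <;> omega
        · refine ⟨⟨min (x - s) (r - s - 1), by omega⟩, Fin.ext ?_⟩
          rw [hα₂ x hx]
          simp only
          split_ifs <;> omega
      · rintro ⟨t, rfl⟩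
        by_cases ht : (t : ℕ) < r - s
        · refine ⟨⟨t + s, by omega⟩, Fin.ext ?_⟩
          rw [hα₂ _ (by simp)]
          simp only [if_pos ht]
          omega
        · refine ⟨⟨t - (r - s), by omega⟩, Fin.ext ?_⟩
          rw [hα₁ _ (by simp only; omega)]
          simp only [if_neg ht]
          omega
    rw [rnk, this, ← Set.image_univ, Set.ncard_image_of_injective]
    · simp [Set.ncard_univ]
    · intro t t' h
      simp only [Fin.mk.injEq] at h
      apply Fin.ext
      split_ifs at h <;> omega
  refine le_trans ?_ (arcLen_le_tourRankLen hrank hr)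
  refine le_arcLen (exists_word_of_strong (isTournament_pathTour n)
    (isStrongDigraph_pathTour hn) (by omega)) fun w hw hwα => ?_
  let φ : Fin n → (Fin n → Fin n) → ℤ := fun x β =>
    if (x : ℕ) < s then (α x : ℤ) - β x else if β x = x then 1 else 0
  have hmain := potential_le_length (D := pathTour n) (α := α) φ ?_ ?_ ?_ hw hwα
  · have h1 : ∀ x ∈ Finset.univ, φ x id = 1 + if (x : ℕ) < s then ((n : ℤ) - s - 1) else 0 := by
      intro x _
      by_cases hx : (x : ℕ) < s
      · have := hα₁ x hx
        simp only [φ, if_pos hx, id]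
        omega
      · simp [φ, hx]
    rw [Finset.sum_congr rfl h1, Finset.sum_add_distrib, ← Finset.sum_filter] at hmain
    have h2 : (Finset.univ.filter fun x : Fin n => (x : ℕ) < s).card = s := by
      rw [Fin.card_filter_val_lt]
      omega
    simp only [Finset.sum_const, h2, Finset.card_univ, Fintype.card_fin, nsmul_eq_mul,
      mul_one] at hmain
    zify [show s ≤ n by omega]
    linarith
  · intro x
    simp only [φ]
    split_ifs with h1 h2
    · simp
    · have h3 := hα₂ x h1
      rw [h2] at h3
      omega
    · rfl
  · intro β a b hab x
    simp only [φ, Function.comp, arcMap]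
    simp only [pathTour] at hab
    split_ifs with h1 h2 h3 h4 <;> (try subst h2) <;> omega
  · intro β a b hab hker
    have key : ∀ x, φ x (arcMap a b ∘ β) < φ x β →
        β x = a ∧ ((x : ℕ) < s ∨ x = a) := by
      intro x hx
      simp only [φ] at hx
      by_cases h : β x = a
      · refine ⟨h, or_iff_not_imp_left.2 fun hxs => ?_⟩
        by_contra hc
        have h2 : β x ≠ x := fun h2 => hc (h2.symm.trans h)
        rw [if_neg hxs, if_neg hxs, if_neg h2] at hx
        split_ifs at hx <;> omega
      · have : (arcMap a b ∘ β) x = β x := if_neg h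
        rw [this] at hx
        exact absurd hx (lt_irrefl _)
    intro x y hx hy
    obtain ⟨hx1, hx2⟩ := key x hx
    obtain ⟨hy1, hy2⟩ := key y hy
    have hxy := congrArg Fin.val (hker x y (hx1.trans hy1.symm))
    by_cases h1 : (x : ℕ) < s <;> by_cases h2 : (y : ℕ) < s
    · rw [hα₁ x h1, hα₁ y h2] at hxy
      exact Fin.ext (by omega)
    · rw [hα₁ x h1, hα₂ y h2] at hxy
      omega
    · rw [hα₂ x h1, hα₁ y h2] at hxy
      omega
    · rw [hx2.resolve_left h1, hy2.resolve_left h2]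

/-- for odd `n ≥ 3` and `2 ≤ r ≤ n−1`,
`n + r − 2 ≤ ℓ_min^Tour(n,r) ≤ n + 8r` and
`(r̂+1)(n−r̂) − 1 ≤ ℓ_max^Tour(n,r) ≤ 6rn + n − 10r` where `r̂ = min (r−1) ⌊n/2⌋`. -/
theorem stmt19 (n : ℕ) (hn : 3 ≤ n) (hodd : Odd n) (r : ℕ) (hr1 : 2 ≤ r)
    (hr2 : r ≤ n - 1) :
    n + r - 2 ≤ lminTour n r ∧ lminTour n r ≤ n + 8 * r ∧
    (min (r - 1) (n / 2) + 1) * (n - min (r - 1) (n / 2)) - 1 ≤ lmaxTour n r ∧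
    lmaxTour n r ≤ 6 * r * n + n - 10 * r := by
  have hrn : r < n := by omega
  obtain ⟨m, hm⟩ := hodd
  have hstrong : IsStrongDigraph (circulantTour n m) := fun u v => by
    obtain ⟨k, -, hk⟩ := circulantTour_diameter (by omega) hm u v
    exact hk.reflTransGen
  refine ⟨?_, ?_, ?_, ?_⟩
  · rw [lminTour]
    refine le_csInf ⟨_, _, isTournament_circulantTour n m, hstrong, rfl⟩ ?_
    rintro k ⟨T, hT, hS, rfl⟩
    have := le_tourRankLen hr1 hrn hT hS
    omega
  · rw [lminTour]
    refine le_trans (Nat.sInf_le ⟨_, isTournament_circulantTour n m, hstrong, rfl⟩) ?_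
    have := tourRankLen_le_of_diameter_le hrn (isTournament_circulantTour n m)
      (circulantTour_diameter (by omega) hm)
    omega
  · refine le_trans ?_ (le_csSup (bddAbove_tourRankLen n r)
      ⟨_, isTournament_pathTour n, isStrongDigraph_pathTour hn, rfl⟩)
    have := le_tourRankLen_pathTour (s := min (r - 1) (n / 2)) hn hrn (by omega) (by omega)
    omega
  · refine csSup_le' ?_
    rintro k ⟨T, hT, hS, rfl⟩
    have h := tourRankLen_le_of_diameter_le (d := n - 1) hrn hT
      (by simpa using exists_stepsTo_lt_card hT hS)
    obtain ⟨c, hc⟩ : ∃ c, 4 * (n - 1) - 3 = c ∧ c + 7 = 4 * n := ⟨_, rfl, by omega⟩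
    rw [hc.1] at h
    have h2 : 3 * r * c + 21 * r = 2 * (6 * r * n) := by
      have := congrArg (fun z => 3 * r * z) hc.2
      linarith
    omega
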